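/- Suppose f_1 = f, and suppose there exists h_0 > 0 such that K(h) = 0 whenever ‖h‖₂ > h_0, and that z_j − y_j > h_0 for every j ∈ {1,…,d}. Then for every ν, ω ∈ F_z, f̃_1(ν,ω) − f(ν,ω) = 0. -/

import Mathlib

open MeasureTheory Matrix
open scoped Real BigOperators

noncomputable section

/-- `e2 t = exp(2 π i t)`. -/
def e2 (t : ℝ) : ℂ := Complex.exp (2 * Real.pi * Complex.I * t)

/-- dot product `ω · x` between a frequency and a lattice point. -/
def dotp {d : ℕ} (ω : Fin d → ℝ) (x : Fin d → ℤ) : ℝ := ∑ j, ω j * (x j : ℝ)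

/-- The lattice `J_y = {1,…,y_1} × ⋯ × {1,…,y_d} ⊆ ℤ^d`. -/
def latJ {d : ℕ} (y : Fin d → ℕ) : Finset (Fin d → ℤ) :=
  Finset.Icc 1 (fun j => (y j : ℤ))

/-- Fourier frequency `(k_1/z_1, …, k_d/z_d)`. -/
def freq {d : ℕ} (z : Fin d → ℕ) (k : ∀ j, Fin (z j)) : Fin d → ℝ :=
  fun j => (k j : ℝ) / (z j : ℝ)

/-- `K(h) = ∫_{[0,1]^d} e^{2πi ω·h} f(ω) dω`. -/
def covK {d : ℕ} (f : (Fin d → ℝ) → ℝ) (h : Fin d → ℤ) : ℂ :=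
  ∫ ω in Set.Icc (0 : Fin d → ℝ) 1, e2 (dotp ω h) * (f ω : ℂ)

/-- `R₁(h) = m⁻¹ Σ_{ω ∈ F_z} f₁(ω) e^{2πi ω·h}`, the periodic covariance. -/
def covR {d : ℕ} (z : Fin d → ℕ) (f₁ : (Fin d → ℝ) → ℝ) (h : Fin d → ℤ) : ℂ :=
  (1 / ((∏ j, z j : ℕ) : ℂ)) *
    ∑ k : (∀ j, Fin (z j)), (f₁ (freq z k) : ℂ) * e2 (dotp (freq z k) h)

/-- Index set for block partitioning `J_z` into `S₁` and `J_z ∖ S₁`. -/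
abbrev obsIdx {d : ℕ} (z : Fin d → ℕ) (S₁ : Finset (Fin d → ℤ)) : Type :=
  {x // x ∈ S₁} ⊕ {x // x ∈ latJ z \ S₁}

/-- The lattice point corresponding to an index. -/
def pt {d : ℕ} {z : Fin d → ℕ} {S₁ : Finset (Fin d → ℤ)} (e : obsIdx z S₁) : Fin d → ℤ :=
  Sum.elim Subtype.val Subtype.val e

/-- The matrix `S = [K, K A₁⁻¹ B₁ ; B₁† A₁⁻¹ K, C₁ − B₁† A₁⁻¹ B₁ + B₁† A₁⁻¹ K A₁⁻¹ B₁]`. -/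
def matS {d : ℕ} (z : Fin d → ℕ) (S₁ : Finset (Fin d → ℤ)) (f f₁ : (Fin d → ℝ) → ℝ) :
    Matrix (obsIdx z S₁) (obsIdx z S₁) ℂ :=
  let K : Matrix {x // x ∈ S₁} {x // x ∈ S₁} ℂ := fun a b => covK f (a.1 - b.1)
  let A₁ : Matrix {x // x ∈ S₁} {x // x ∈ S₁} ℂ := fun a b => covR z f₁ (a.1 - b.1)
  let B₁ : Matrix {x // x ∈ S₁} {x // x ∈ latJ z \ S₁} ℂ := fun a b => covR z f₁ (a.1 - b.1)
  let C₁ : Matrix {x // x ∈ latJ z \ S₁} {x // x ∈ latJ z \ S₁} ℂ :=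
    fun a b => covR z f₁ (a.1 - b.1)
  Matrix.fromBlocks K (K * A₁⁻¹ * B₁) (B₁ᴴ * A₁⁻¹ * K)
    (C₁ - B₁ᴴ * A₁⁻¹ * B₁ + B₁ᴴ * A₁⁻¹ * K * A₁⁻¹ * B₁)

/-- The vector `g(ν)` with entries `m^{-1/2} e^{2πi ν·x}`, `x ∈ J_z`. -/
def gvec {d : ℕ} (z : Fin d → ℕ) (S₁ : Finset (Fin d → ℤ)) (ν : Fin d → ℝ) :
    obsIdx z S₁ → ℂ :=
  fun e => ((1 / Real.sqrt (∏ j, z j : ℕ) : ℝ) : ℂ) * e2 (dotp ν (pt e))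

/-- `f̃₁(ν, ω) = g(ν)† S g(ω)`. -/
def ftilde {d : ℕ} (z : Fin d → ℕ) (S₁ : Finset (Fin d → ℤ)) (f f₁ : (Fin d → ℝ) → ℝ)
    (ν ω : Fin d → ℝ) : ℂ :=
  star (gvec z S₁ ν) ⬝ᵥ (matS z S₁ f f₁ *ᵥ gvec z S₁ ω)

open Classical in
/-- `f(ν, ω) = f(ν)` if `ν = ω` and `0` otherwise. -/
def fdiag {d : ℕ} (f : (Fin d → ℝ) → ℝ) (ν ω : Fin d → ℝ) : ℂ :=
  if ν = ω then (f ν : ℂ) else 0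


/-- The normalised Haar measure on `ℝ / ℤ`, as used for multivariate Fourier series. -/
abbrev unitAddCircleHaar : MeasureSpace UnitAddCircle := ⟨AddCircle.haarAddCircle⟩

attribute [local instance] unitAddCircleHaar

theorem mFourier_coe {d : ℕ} (n : Fin d → ℤ) (x : Fin d → ℝ) :
    UnitAddTorus.mFourier n (fun i => (x i : UnitAddCircle)) = e2 (dotp x n) := by
  simp only [UnitAddTorus.mFourier, ContinuousMap.coe_mk, fourier_coe_apply, e2, dotp,
    ← Complex.exp_sum]
  congr 1
  push_cast
  rw [Finset.mul_sum]
  exact Finset.sum_congr rfl fun i _ => by ring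

theorem continuous_e2_dotp {d : ℕ} (n : Fin d → ℤ) :
    Continuous fun x : Fin d → ℝ => e2 (dotp x n) := by
  unfold e2 dotp
  fun_prop

/-- A continuous function on the unit cube with finitely many nonzero Fourier coefficients
agrees with its Fourier series on the whole closed cube. -/
theorem eqOn_fourier_sum {d : ℕ} {g : (Fin d → ℝ) → ℂ}
    (hg : ContinuousOn g (Set.Icc 0 1)) (T : Finset (Fin d → ℤ))
    (hT : ∀ n ∉ T, ∫ ω in Set.Icc (0 : Fin d → ℝ) 1, e2 (dotp ω (-n)) * g ω = 0) :
    Set.EqOn g (fun x => ∑ n ∈ T,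
      (∫ ω in Set.Icc (0 : Fin d → ℝ) 1, e2 (dotp ω (-n)) * g ω) * e2 (dotp x n))
      (Set.Icc 0 1) := by
  have : IsProbabilityMeasure (volume : Measure UnitAddCircle) :=
    inferInstanceAs (IsProbabilityMeasure AddCircle.haarAddCircle)
  set I : Set (Fin d → ℝ) := {x | ∀ i, x i ∈ Set.Ioc ((0 : Fin d → ℝ) i) ((0 : Fin d → ℝ) i + 1)}
    with hI
  have hI_pi : I = Set.univ.pi fun i => Set.Ioc ((0 : Fin d → ℝ) i) ((1 : Fin d → ℝ) i) := by
    ext x; simp [hI]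
  have hI_meas : MeasurableSet I := by
    rw [hI_pi]; exact MeasurableSet.univ_pi fun i => measurableSet_Ioc
  have hI_ae : I =ᵐ[volume] Set.Icc (0 : Fin d → ℝ) 1 := by
    rw [hI_pi]; exact Measure.univ_pi_Ioc_ae_eq_Icc
  have hI_sub : I ⊆ Set.Icc 0 1 := fun x hx =>
    ⟨fun i => (hx i).1.le, fun i => by simpa using (hx i).2⟩
  let G : UnitAddTorus (Fin d) → ℂ := fun t => g (UnitAddTorus.measurableEquivPiIoc 0 t).1
  have hG_coe : ∀ x ∈ I, G (fun i => (x i : UnitAddCircle)) = g x := fun x hx => by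
    have := (UnitAddTorus.measurableEquivPiIoc (0 : Fin d → ℝ)).apply_symm_apply ⟨x, hx⟩
    rw [UnitAddTorus.coe_symm_measurableEquivPiIoc_apply] at this
    simp only [G, this]
  have hG_meas : Measurable G := by
    have : Continuous fun x : I => g x.1 :=
      continuousOn_iff_continuous_domRestrict.mp (hg.mono hI_sub)
    exact this.measurable.comp (UnitAddTorus.measurableEquivPiIoc (0 : Fin d → ℝ)).measurable
  obtain ⟨C, hC⟩ := isCompact_Icc.exists_bound_of_continuousOn hg
  have hG_mem : MemLp G 2 (volume : Measure (UnitAddTorus (Fin d))) := by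
    exact MemLp.of_bound hG_meas.aestronglyMeasurable C
      (Filter.Eventually.of_forall fun t => hC _ (hI_sub (UnitAddTorus.measurableEquivPiIoc 0 t).2))
  have hcoef : ∀ n, UnitAddTorus.mFourierCoeff (hG_mem.toLp G) n =
      ∫ ω in Set.Icc (0 : Fin d → ℝ) 1, e2 (dotp ω (-n)) * g ω := fun n => by
    trans UnitAddTorus.mFourierCoeff G n
    · exact integral_congr_ae (Filter.EventuallyEq.rfl.smul hG_mem.coeFn_toLp)
    · rw [UnitAddTorus.mFourierCoeff_eq_integral G n 0, ← setIntegral_congr_set hI_ae]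
      refine setIntegral_congr_fun hI_meas fun x hx => ?_
      simp only [smul_eq_mul]
      rw [hG_coe x hx, mFourier_coe]
  let c : (Fin d → ℤ) → ℂ := fun n => ∫ ω in Set.Icc (0 : Fin d → ℝ) 1, e2 (dotp ω (-n)) * g ω
  let P : C(UnitAddTorus (Fin d), ℂ) := ∑ n ∈ T, c n • UnitAddTorus.mFourier n
  have hGP : G =ᵐ[volume] P := by
    have h1 := UnitAddTorus.hasSum_mFourier_series_L2 (hG_mem.toLp G)
    simp only [hcoef] at h1
    have h2 := h1.unique (hasSum_sum_of_ne_finset_zero (s := T) fun n hn => by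
      rw [hT n hn, zero_smul])
    have h3 : hG_mem.toLp G = ContinuousMap.toLp 2 volume ℂ P := by
      rw [h2]; simp [P, c, UnitAddTorus.mFourierLp]
    have h4 := hG_mem.coeFn_toLp
    rw [h3] at h4
    exact h4.symm.trans (ContinuousMap.coeFn_toLp volume P)
  have hgP : g =ᵐ[volume.restrict I] fun x => ∑ n ∈ T, c n * e2 (dotp x n) := by
    have h1 := (UnitAddTorus.measurePreserving_equivPiIoc (0 : Fin d → ℝ)).symm
      |>.quasiMeasurePreserving.ae_eq_comp hGP
    refine (ae_restrict_iff_subtype hI_meas).2 ?_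
    filter_upwards [h1] with x hx
    have hx' : G (fun i => (x.1 i : UnitAddCircle)) = P (fun i => (x.1 i : UnitAddCircle)) := hx
    rw [hG_coe x.1 x.2] at hx'
    rw [hx']
    simp [P, mFourier_coe]
  rw [Measure.restrict_congr_set hI_ae] at hgP
  refine Measure.eqOn_of_ae_eq hgP hg ?_ ?_
  · exact (continuous_finsetSum _ fun n _ =>
      continuous_const.mul (continuous_e2_dotp n)).continuousOn
  · rw [← Set.pi_univ_Icc, interior_pi_set Set.finite_univ, closure_pi_set]
    simp [interior_Icc, closure_Ioo]

theorem e2_add (s t : ℝ) : e2 (s + t) = e2 s * e2 t := by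
  rw [e2, e2, e2, ← Complex.exp_add]
  congr 1
  push_cast
  ring

theorem star_e2 (t : ℝ) : star (e2 t) = e2 (-t) := by
  rw [e2, e2, Complex.star_def, ← Complex.exp_conj]
  simp [Complex.conj_ofNat]

theorem dotp_add {d : ℕ} (ω : Fin d → ℝ) (x x' : Fin d → ℤ) :
    dotp ω (x + x') = dotp ω x + dotp ω x' := by
  simp [dotp, mul_add, Finset.sum_add_distrib]

theorem dotp_sub {d : ℕ} (ω : Fin d → ℝ) (x x' : Fin d → ℤ) :
    dotp ω (x - x') = dotp ω x + -dotp ω x' := by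
  simp [dotp, mul_sub, ← sub_eq_add_neg]

theorem sum_fin_e2_div_mul (n : ℕ) (hn : 0 < n) (a : ℤ) :
    ∑ k : Fin n, e2 ((k : ℝ) / n * a) = if (n : ℤ) ∣ a then (n : ℂ) else 0 := by
  have hζ := Complex.isPrimitiveRoot_exp n hn.ne'
  set ζ : ℂ := Complex.exp (2 * Real.pi * Complex.I / n) with hζ_def
  have hterm : ∀ k : Fin n, e2 ((k : ℝ) / n * a) = (ζ ^ a) ^ (k : ℕ) := fun k => by
    rw [e2, hζ_def, ← Complex.exp_int_mul, ← Complex.exp_nat_mul]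
    congr 1
    push_cast
    ring
  simp_rw [hterm]
  rw [Fin.sum_univ_eq_sum_range (fun k => (ζ ^ a) ^ k) n]
  split_ifs with h
  · rw [(hζ.zpow_eq_one_iff_dvd a).2 h]
    simp
  · have h1 : ζ ^ a ≠ 1 := fun h' => h ((hζ.zpow_eq_one_iff_dvd a).1 h')
    have h2 : (ζ ^ a) ^ n = 1 := by
      rw [← zpow_natCast, ← _root_.zpow_mul, mul_comm, _root_.zpow_mul, zpow_natCast, hζ.pow_eq_one, _root_.one_zpow]
    rw [geom_sum_eq h1, h2, sub_self, zero_div]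

/-- Orthogonality of the characters of `∏ j, ℤ / z_j`. -/
theorem sum_e2_dotp_freq {d : ℕ} (z : Fin d → ℕ) (hz : ∀ j, 0 < z j) (a : Fin d → ℤ) :
    ∑ k : (∀ j, Fin (z j)), e2 (dotp (freq z k) a) =
      if ∀ j, (z j : ℤ) ∣ a j then ((∏ j, z j : ℕ) : ℂ) else 0 := by
  have hprod : ∀ k : (∀ j, Fin (z j)),
      e2 (dotp (freq z k) a) = ∏ j, e2 ((k j : ℝ) / z j * a j) := fun k => by
    simp only [e2, dotp, freq, ← Complex.exp_sum, Complex.ofReal_sum, Finset.mul_sum]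
  simp_rw [hprod]
  rw [← Fintype.piFinset_univ, ← Finset.prod_univ_sum (fun j => (Finset.univ : Finset (Fin (z j))))
    (fun j k => e2 ((k : ℝ) / z j * a j))]
  simp_rw [sum_fin_e2_div_mul _ (hz _)]
  rw [Finset.prod_ite_zero]
  simp

theorem freq_mem_Icc {d : ℕ} (z : Fin d → ℕ) (k : ∀ j, Fin (z j)) :
    freq z k ∈ Set.Icc (0 : Fin d → ℝ) 1 :=
  ⟨fun j => by simp only [freq, Pi.zero_apply]; positivity, fun j =>
    div_le_one_of_le₀ (Nat.cast_le.2 (k j).2.le) (Nat.cast_nonneg _)⟩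

theorem freq_injective {d : ℕ} (z : Fin d → ℕ) (hz : ∀ j, 0 < z j) :
    Function.Injective (freq z) := fun k k' h => by
  ext j
  have hj := congrFun h j
  have : (z j : ℝ) ≠ 0 := by exact_mod_cast (hz j).ne'
  simp only [freq] at hj
  exact_mod_cast (div_left_inj' this).1 hj

/-- If `K` vanishes off the box of radius `N`, the periodic covariance reproduces `K` at every
lag that stays at distance more than `N` from the wrap-around. -/
theorem covR_eq_covK {d : ℕ} (z : Fin d → ℕ) (hz : ∀ j, 0 < z j) {f : (Fin d → ℝ) → ℝ}
    (hf : ContinuousOn f (Set.Icc 0 1)) (N : ℤ)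
    (hK : ∀ h : Fin d → ℤ, (∃ j, N < |h j|) → covK f h = 0)
    (h : Fin d → ℤ) (hh : ∀ j, |h j| + N < z j) : covR z f h = covK f h := by
  let T : Finset (Fin d → ℤ) := Finset.Icc (fun _ => -N) (fun _ => N)
  have hmem : ∀ n, n ∈ T ↔ ∀ j, |n j| ≤ N := fun n => by
    simp only [T, Finset.mem_Icc, Pi.le_def, abs_le, forall_and]
  have hKT : ∀ n ∉ T, covK f (-n) = 0 := fun n hn => by
    rw [hmem] at hn
    push Not at hn
    exact hK _ (by simpa using hn)
  have hseries := eqOn_fourier_sum (g := fun ω => (f ω : ℂ))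
    (Complex.continuous_ofReal.comp_continuousOn hf) T hKT
  have hm : ((∏ j, z j : ℕ) : ℂ) ≠ 0 := by
    exact_mod_cast (Finset.prod_pos fun j _ => hz j).ne'
  have hswap : ∑ k : (∀ j, Fin (z j)), (f (freq z k) : ℂ) * e2 (dotp (freq z k) h) =
      ∑ n ∈ T, covK f (-n) * ∑ k : (∀ j, Fin (z j)), e2 (dotp (freq z k) (n + h)) := by
    simp_rw [Finset.mul_sum]
    rw [Finset.sum_comm]
    refine Finset.sum_congr rfl fun k _ => ?_
    have := hseries (freq_mem_Icc z k)
    simp only at this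
    rw [this, Finset.sum_mul]
    refine Finset.sum_congr rfl fun n _ => ?_
    rw [dotp_add, e2_add, covK, mul_assoc]
  have hsingle : ∑ n ∈ T, covK f (-n) * ∑ k : (∀ j, Fin (z j)), e2 (dotp (freq z k) (n + h)) =
      covK f h * ((∏ j, z j : ℕ) : ℂ) := by
    rw [Finset.sum_eq_single (-h)]
    · rw [sum_e2_dotp_freq z hz]
      simp
    · intro n hn hne
      rw [sum_e2_dotp_freq z hz, if_neg, mul_zero]
      intro hdvd
      refine hne (eq_neg_of_add_eq_zero_left (funext fun j => ?_))
      refine Int.eq_zero_of_abs_lt_dvd (hdvd j) ?_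
      have h1 := (hmem n).1 hn j
      have h2 := hh j
      have h3 := abs_add_le (n j) (h j)
      simp only [Pi.add_apply]
      omega
    · intro hh'
      rw [hKT _ hh', zero_mul]
  rw [covR, hswap, hsingle]
  field_simp

/-- The periodic covariance matrix on the embedding lattice. -/
def covRMatrix {d : ℕ} (z : Fin d → ℕ) (S₁ : Finset (Fin d → ℤ)) (f : (Fin d → ℝ) → ℝ) :
    Matrix (obsIdx z S₁) (obsIdx z S₁) ℂ :=
  Matrix.of fun a b => covR z f (pt a - pt b)

/-- The discrete Fourier matrix, whose columns are the vectors `g(ν)`. -/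
def fourierMatrix {d : ℕ} (z : Fin d → ℕ) (S₁ : Finset (Fin d → ℤ)) :
    Matrix (obsIdx z S₁) (∀ j, Fin (z j)) ℂ :=
  Matrix.of fun a k => gvec z S₁ (freq z k) a

theorem gvec_mul_star_gvec {d : ℕ} (z : Fin d → ℕ) (S₁ : Finset (Fin d → ℤ)) (ν : Fin d → ℝ)
    (a b : obsIdx z S₁) :
    gvec z S₁ ν a * star (gvec z S₁ ν b) =
      (1 / ((∏ j, z j : ℕ) : ℂ)) * e2 (dotp ν (pt a - pt b)) := by
  have hsq : ((1 / Real.sqrt (∏ j, z j : ℕ) : ℝ) : ℂ) * ((1 / Real.sqrt (∏ j, z j : ℕ) : ℝ) : ℂ) =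
      1 / ((∏ j, z j : ℕ) : ℂ) := by
    rw [← Complex.ofReal_mul, div_mul_div_comm, Real.mul_self_sqrt (Nat.cast_nonneg _)]
    push_cast
    simp
  rw [dotp_sub, e2_add, ← star_e2, ← hsq]
  simp only [gvec, star_mul', Complex.star_def, Complex.conj_ofReal]
  ring

theorem covRMatrix_eq {d : ℕ} (z : Fin d → ℕ) (S₁ : Finset (Fin d → ℤ)) (f : (Fin d → ℝ) → ℝ) :
    covRMatrix z S₁ f = fourierMatrix z S₁ * diagonal (fun k => (f (freq z k) : ℂ)) *
      (fourierMatrix z S₁)ᴴ := by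
  ext a b
  rw [Matrix.mul_apply]
  simp only [covRMatrix, covR, of_apply, mul_diagonal, conjTranspose_apply, fourierMatrix]
  rw [Finset.mul_sum]
  refine Finset.sum_congr rfl fun k _ => ?_
  rw [mul_right_comm, gvec_mul_star_gvec]
  ring

theorem pt_mem_latJ {d : ℕ} {z : Fin d → ℕ} {S₁ : Finset (Fin d → ℤ)} (hS : S₁ ⊆ latJ z)
    (a : obsIdx z S₁) : pt a ∈ latJ z := by
  rcases a with a | a
  · exact hS a.2
  · exact (Finset.mem_sdiff.1 a.2).1

theorem pt_injective {d : ℕ} {z : Fin d → ℕ} {S₁ : Finset (Fin d → ℤ)} :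
    Function.Injective (pt : obsIdx z S₁ → Fin d → ℤ) :=
  Function.Injective.sumElim Subtype.val_injective Subtype.val_injective fun a b h =>
    (Finset.mem_sdiff.1 b.2).2 (h ▸ a.2)

theorem abs_sub_lt_of_mem_latJ {d : ℕ} {y : Fin d → ℕ} {x x' : Fin d → ℤ} (hx : x ∈ latJ y)
    (hx' : x' ∈ latJ y) (j : Fin d) : |(x - x') j| < y j := by
  simp only [latJ, Finset.mem_Icc, Pi.le_def, Pi.one_apply] at hx hx'
  have := hx.1 j
  have := hx.2 j
  have := hx'.1 j
  have := hx'.2 j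
  rw [Pi.sub_apply, abs_lt]
  omega

theorem card_obsIdx {d : ℕ} {z : Fin d → ℕ} {S₁ : Finset (Fin d → ℤ)} (hS : S₁ ⊆ latJ z) :
    Fintype.card (obsIdx z S₁) = ∏ j, z j := by
  rw [Fintype.card_sum, Fintype.card_coe, Fintype.card_coe, add_comm,
    Finset.card_sdiff_add_card_eq_card hS, latJ, Pi.card_Icc]
  simp

theorem fourierMatrix_mul_conjTranspose {d : ℕ} {z : Fin d → ℕ} (hz : ∀ j, 0 < z j)
    {S₁ : Finset (Fin d → ℤ)} (hS : S₁ ⊆ latJ z) :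
    fourierMatrix z S₁ * (fourierMatrix z S₁)ᴴ = 1 := by
  ext a b
  have hm : ((∏ j, z j : ℕ) : ℂ) ≠ 0 := by
    exact_mod_cast (Finset.prod_pos fun j _ => hz j).ne'
  simp only [Matrix.mul_apply, conjTranspose_apply, fourierMatrix, of_apply, gvec_mul_star_gvec]
  rw [← Finset.mul_sum, sum_e2_dotp_freq z hz, Matrix.one_apply]
  have hiff : (∀ j, (z j : ℤ) ∣ (pt a - pt b) j) ↔ a = b := by
    refine ⟨fun h => pt_injective (sub_eq_zero.1 (funext fun j => ?_)), fun h => by simp [h]⟩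
    exact Int.eq_zero_of_abs_lt_dvd (h j)
      (abs_sub_lt_of_mem_latJ (pt_mem_latJ hS a) (pt_mem_latJ hS b) j)
  simp only [hiff]
  split_ifs
  · field_simp
  · simp

theorem conjTranspose_mul_fourierMatrix {d : ℕ} {z : Fin d → ℕ} (hz : ∀ j, 0 < z j)
    {S₁ : Finset (Fin d → ℤ)} (hS : S₁ ⊆ latJ z) :
    (fourierMatrix z S₁)ᴴ * fourierMatrix z S₁ = 1 :=
  (mul_eq_one_comm_of_card_eq _ _ _ (by rw [card_obsIdx hS]; simp)).1 (fourierMatrix_mul_conjTranspose hz hS)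

open scoped ComplexOrder in
theorem posDef_covRMatrix {d : ℕ} {z : Fin d → ℕ} (hz : ∀ j, 0 < z j)
    {S₁ : Finset (Fin d → ℤ)} (hS : S₁ ⊆ latJ z) {f : (Fin d → ℝ) → ℝ}
    (hf : ∀ ω ∈ Set.Icc (0 : Fin d → ℝ) 1, 0 < f ω) : (covRMatrix z S₁ f).PosDef := by
  rw [covRMatrix_eq]
  refine PosDef.mul_mul_conjTranspose_same ?_ ?_
  · exact posDef_diagonal_iff.2 fun k => by exact_mod_cast hf _ (freq_mem_Icc z k)
  · exact Function.LeftInverse.injective (g := fun v => v ᵥ* (fourierMatrix z S₁)ᴴ) fun v => by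
      simp only [vecMul_vecMul, fourierMatrix_mul_conjTranspose hz hS, vecMul_one]

open scoped ComplexOrder in
/-- When `K` and `R` agree on the lags of the observation set, `S` is the periodic covariance
matrix. -/
theorem matS_eq_covRMatrix {d : ℕ} {z : Fin d → ℕ} (hz : ∀ j, 0 < z j)
    {S₁ : Finset (Fin d → ℤ)} (hS : S₁ ⊆ latJ z) {f : (Fin d → ℝ) → ℝ}
    (hf : ∀ ω ∈ Set.Icc (0 : Fin d → ℝ) 1, 0 < f ω)
    (hKR : ∀ x ∈ S₁, ∀ x' ∈ S₁, covR z f (x - x') = covK f (x - x')) :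
    matS z S₁ f f = covRMatrix z S₁ f := by
  have hpd := posDef_covRMatrix hz hS hf
  set M := covRMatrix z S₁ f
  have hA : IsUnit M.toBlocks₁₁ := (hpd.submatrix Sum.inl_injective).isUnit
  have hBC : M.toBlocks₁₂ᴴ = M.toBlocks₂₁ := by
    ext a b
    exact hpd.isHermitian.apply (Sum.inr a) (Sum.inl b)
  let K : Matrix {x // x ∈ S₁} {x // x ∈ S₁} ℂ := fun a b => covK f (a.1 - b.1)
  have hKA : K = M.toBlocks₁₁ := by
    ext a b
    exact (hKR a a.2 b b.2).symm
  have hdet := (Matrix.isUnit_iff_isUnit_det _).1 hA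
  change Matrix.fromBlocks K (K * M.toBlocks₁₁⁻¹ * M.toBlocks₁₂)
    (M.toBlocks₁₂ᴴ * M.toBlocks₁₁⁻¹ * K)
    (M.toBlocks₂₂ - M.toBlocks₁₂ᴴ * M.toBlocks₁₁⁻¹ * M.toBlocks₁₂ +
      M.toBlocks₁₂ᴴ * M.toBlocks₁₁⁻¹ * K * M.toBlocks₁₁⁻¹ * M.toBlocks₁₂) = M
  rw [hKA, mul_nonsing_inv _ hdet, Matrix.one_mul, nonsing_inv_mul_cancel_right _ _ hdet,
    sub_add_cancel, hBC, fromBlocks_toBlocks]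

/-- if `f₁ = f`, `K(h) = 0` whenever `‖h‖₂ > h₀`, and `z_j − y_j > h₀` for
every `j`, then `f̃₁(ν,ω) − f(ν,ω) = 0` for every Fourier frequencies `ν, ω ∈ F_z`. -/
theorem stmt_2 (d : ℕ) (hd : 1 ≤ d) (y z : Fin d → ℕ) (hyz : ∀ j, 1 ≤ y j ∧ y j ≤ z j)
    (S₁ : Finset (Fin d → ℤ)) (hS₁ : S₁ ⊆ latJ y) (hS₁ne : S₁.Nonempty)
    (hcard : S₁.card < ∏ j, z j)
    (f : (Fin d → ℝ) → ℝ)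
    (hfcont : ContinuousOn f (Set.Icc 0 1))
    (hfpos : ∀ ω ∈ Set.Icc (0 : Fin d → ℝ) 1, 0 < f ω)
    (h₀ : ℝ) (hh₀ : 0 < h₀)
    (hK : ∀ h : Fin d → ℤ, h₀ < Real.sqrt (∑ j, ((h j : ℝ)) ^ 2) → covK f h = 0)
    (hzy : ∀ j, h₀ < (z j : ℝ) - (y j : ℝ)) :
    ∀ k k' : (∀ j, Fin (z j)),
      ftilde z S₁ f f (freq z k) (freq z k') - fdiag f (freq z k) (freq z k') = 0 := by
  intro k k'
  have hz : ∀ j, 0 < z j := fun j => (hyz j).1.trans (hyz j).2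
  have hS : S₁ ⊆ latJ z := hS₁.trans <| Finset.Icc_subset_Icc le_rfl fun j =>
    Nat.cast_le.2 (hyz j).2
  have hK_box : ∀ h : Fin d → ℤ, (∃ j, ⌊h₀⌋ < |h j|) → covK f h = 0 := fun h ⟨j, hj⟩ => by
    refine hK h ?_
    calc h₀ < |(h j : ℝ)| := by exact_mod_cast Int.floor_lt.1 hj
      _ ≤ _ := Real.abs_le_sqrt
        (Finset.single_le_sum (f := fun i => (h i : ℝ) ^ 2) (fun _ _ => sq_nonneg _)
          (Finset.mem_univ j))
  have hKR : ∀ x ∈ S₁, ∀ x' ∈ S₁, covR z f (x - x') = covK f (x - x') := fun x hx x' hx' => by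
    refine covR_eq_covK z hz hfcont ⌊h₀⌋ hK_box _ fun j => ?_
    have h1 := abs_sub_lt_of_mem_latJ (hS₁ hx) (hS₁ hx') j
    have h2 : ⌊h₀⌋ < (z j : ℤ) - y j := Int.floor_lt.2 (by exact_mod_cast hzy j)
    omega
  have hdiag : (fourierMatrix z S₁)ᴴ * (covRMatrix z S₁ f * fourierMatrix z S₁) =
      diagonal fun k => (f (freq z k) : ℂ) := by
    rw [covRMatrix_eq, Matrix.mul_assoc, conjTranspose_mul_fourierMatrix hz hS, Matrix.mul_one,
      ← Matrix.mul_assoc, conjTranspose_mul_fourierMatrix hz hS, Matrix.one_mul]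
  have hft : ftilde z S₁ f f (freq z k) (freq z k') =
      ((fourierMatrix z S₁)ᴴ * (covRMatrix z S₁ f * fourierMatrix z S₁)) k k' := by
    rw [ftilde, matS_eq_covRMatrix hz hS hfpos hKR]
    rfl
  rw [hft, hdiag, fdiag, diagonal_apply, sub_eq_zero]
  simp only [(freq_injective z hz).eq_iff]

end
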